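/- Suppose the full-space LFU problem is feasible. Then the set {α ∈ ℝⁿ : (α, H) is a minimizer of the full-space LFU problem for some symmetric H} equals {Q α̂ + v : (α̂, Ĥ) is a minimizer of the subspace LFU problem for some symmetric Ĥ, and v ∈ col(Q)⊥}. -/

import Mathlib

open Matrix

/-- Squared Frobenius norm of a real matrix. -/
noncomputable def frobSq {a b : ℕ} (A : Matrix (Fin a) (Fin b) ℝ) : ℝ :=
  ∑ i, ∑ j, (A i j) ^ 2

/-- Squared Euclidean norm of a real vector. -/
noncomputable def vecNormSq {a : ℕ} (v : Fin a → ℝ) : ℝ :=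
  ∑ i, (v i) ^ 2

/-- `v` lies in the orthogonal complement of the column space of `Q`. -/
def inColPerp {n d : ℕ} (Q : Matrix (Fin n) (Fin d) ℝ) (v : Fin n → ℝ) : Prop :=
  ∀ u : Fin d → ℝ, Q.mulVec u ⬝ᵥ v = 0

/-- Feasibility for the quadratic interpolation constraints: `p = (α, H)` with `H`
symmetric and `(dᵢ)ᵀ α + ½ (dᵢ)ᵀ H dᵢ = rhs i` for all `i`. -/
def QFeas {k m : ℕ} (dd : Fin m → Fin k → ℝ) (rhs : Fin m → ℝ)
    (p : (Fin k → ℝ) × Matrix (Fin k) (Fin k) ℝ) : Prop :=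
  p.2.IsSymm ∧ ∀ i, dd i ⬝ᵥ p.1 + (1 / 2) * (dd i ⬝ᵥ p.2.mulVec (dd i)) = rhs i

/-- Objective of the minimum norm (MN) problem. -/
noncomputable def MNObj {k : ℕ} (p : (Fin k → ℝ) × Matrix (Fin k) (Fin k) ℝ) : ℝ :=
  (1 / 2) * vecNormSq p.1 + (1 / 2) * frobSq p.2

/-- `p` is a minimizer of the MN problem. -/
def MNMin {k m : ℕ} (dd : Fin m → Fin k → ℝ) (rhs : Fin m → ℝ)
    (p : (Fin k → ℝ) × Matrix (Fin k) (Fin k) ℝ) : Prop :=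
  QFeas dd rhs p ∧ ∀ q, QFeas dd rhs q → MNObj p ≤ MNObj q

/-- Objective of the minimum Frobenius norm (MFN) problem. -/
noncomputable def MFNObj {k : ℕ} (p : (Fin k → ℝ) × Matrix (Fin k) (Fin k) ℝ) : ℝ :=
  (1 / 2) * frobSq p.2

/-- `p` is a minimizer of the MFN problem. -/
def MFNMin {k m : ℕ} (dd : Fin m → Fin k → ℝ) (rhs : Fin m → ℝ)
    (p : (Fin k → ℝ) × Matrix (Fin k) (Fin k) ℝ) : Prop :=
  QFeas dd rhs p ∧ ∀ q, QFeas dd rhs q → MFNObj p ≤ MFNObj q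

/-- Objective of the least Frobenius norm updating (LFU) problem. -/
noncomputable def LFUObj {k : ℕ} (Hbar : Matrix (Fin k) (Fin k) ℝ)
    (p : (Fin k → ℝ) × Matrix (Fin k) (Fin k) ℝ) : ℝ :=
  (1 / 2) * frobSq (p.2 - Hbar)

/-- `p` is a minimizer of the LFU problem with reference matrix `Hbar`. -/
def LFUMin {k m : ℕ} (dd : Fin m → Fin k → ℝ) (rhs : Fin m → ℝ)
    (Hbar : Matrix (Fin k) (Fin k) ℝ)
    (p : (Fin k → ℝ) × Matrix (Fin k) (Fin k) ℝ) : Prop :=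
  QFeas dd rhs p ∧ ∀ q, QFeas dd rhs q → LFUObj Hbar p ≤ LFUObj Hbar q

/-- `X` is a Moore–Penrose pseudoinverse of `A`. -/
def IsMPInv {a b : ℕ} (A : Matrix (Fin a) (Fin b) ℝ) (X : Matrix (Fin b) (Fin a) ℝ) : Prop :=
  A * X * A = A ∧ X * A * X = X ∧ (A * X)ᵀ = A * X ∧ (X * A)ᵀ = X * A

/-- The vector `δ_g(y⁰; W)` with `i`-th entry `g(y⁰ + wⁱ) − g(y⁰)`,
where `wⁱ` is the `i`-th column of `W`. -/
noncomputable def deltaVec {k p : ℕ} (g : (Fin k → ℝ) → ℝ) (y0 : Fin k → ℝ)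
    (W : Matrix (Fin k) (Fin p) ℝ) : Fin p → ℝ :=
  fun i => g (y0 + fun j => W j i) - g y0

theorem frobSq_eq_trace {a b : ℕ} (A : Matrix (Fin a) (Fin b) ℝ) :
    frobSq A = (Aᵀ * A).trace := by
  simp only [frobSq, trace, diag_apply, mul_apply, transpose_apply, sq]
  exact Finset.sum_comm

theorem frobSq_nonneg {a b : ℕ} (A : Matrix (Fin a) (Fin b) ℝ) : 0 ≤ frobSq A :=
  Finset.sum_nonneg fun _ _ => Finset.sum_nonneg fun _ _ => sq_nonneg _

theorem transpose_mul_conj {n d : ℕ} {Q : Matrix (Fin n) (Fin d) ℝ} (hQ : Qᵀ * Q = 1)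
    (E : Matrix (Fin d) (Fin d) ℝ) : Qᵀ * (Q * E * Qᵀ) * Q = E := by
  calc Qᵀ * (Q * E * Qᵀ) * Q = (Qᵀ * Q) * E * (Qᵀ * Q) := by simp only [Matrix.mul_assoc]
    _ = E := by rw [hQ, Matrix.one_mul, Matrix.mul_one]

theorem trace_transpose_mul_conj {n d : ℕ} (Q : Matrix (Fin n) (Fin d) ℝ)
    (A : Matrix (Fin n) (Fin n) ℝ) (E : Matrix (Fin d) (Fin d) ℝ) :
    (Aᵀ * (Q * E * Qᵀ)).trace = ((Qᵀ * A * Q)ᵀ * E).trace := by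
  rw [← Matrix.mul_assoc, trace_mul_comm]
  simp only [transpose_mul, transpose_transpose, Matrix.mul_assoc]

/-- Conjugation by a matrix with orthonormal columns preserves the Frobenius norm. -/
theorem frobSq_conj {n d : ℕ} {Q : Matrix (Fin n) (Fin d) ℝ} (hQ : Qᵀ * Q = 1)
    (E : Matrix (Fin d) (Fin d) ℝ) : frobSq (Q * E * Qᵀ) = frobSq E := by
  rw [frobSq_eq_trace, trace_transpose_mul_conj, transpose_mul_conj hQ, frobSq_eq_trace]

/-- Compression to a subspace does not increase the Frobenius norm. -/
theorem frobSq_compress_le {n d : ℕ} {Q : Matrix (Fin n) (Fin d) ℝ} (hQ : Qᵀ * Q = 1)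
    (A : Matrix (Fin n) (Fin n) ℝ) : frobSq (Qᵀ * A * Q) ≤ frobSq A := by
  set E := Qᵀ * A * Q with hE
  have hnonneg := frobSq_nonneg (A - Q * E * Qᵀ)
  have hcross : (Aᵀ * (Q * E * Qᵀ)).trace = frobSq E := by
    rw [trace_transpose_mul_conj, frobSq_eq_trace]
  have hcross' : ((Q * E * Qᵀ)ᵀ * A).trace = frobSq E := by
    rw [← hcross, ← trace_transpose, transpose_mul, transpose_transpose]
  have hself := frobSq_conj hQ E
  rw [frobSq_eq_trace] at hself
  rw [frobSq_eq_trace, transpose_sub, Matrix.sub_mul, Matrix.mul_sub, Matrix.mul_sub,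
    trace_sub, trace_sub, trace_sub, hcross, hcross', hself, ← frobSq_eq_trace] at hnonneg
  linarith

theorem qFeas_mulVec_iff {n d m : ℕ} (Q : Matrix (Fin n) (Fin d) ℝ) (dh : Fin m → Fin d → ℝ)
    (rhs : Fin m → ℝ) (α : Fin n → ℝ) {H : Matrix (Fin n) (Fin n) ℝ} (hH : H.IsSymm) :
    QFeas (fun i => Q.mulVec (dh i)) rhs (α, H) ↔
      QFeas dh rhs (Qᵀ.mulVec α, Qᵀ * H * Q) := by
  have hsymm : (Qᵀ * H * Q).IsSymm := by
    simp only [IsSymm, transpose_mul, transpose_transpose, hH.eq, Matrix.mul_assoc]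
  have hdot (u : Fin d → ℝ) (w : Fin n → ℝ) : Q.mulVec u ⬝ᵥ w = u ⬝ᵥ Qᵀ.mulVec w := by
    rw [dotProduct_mulVec, vecMul_transpose]
  simp only [QFeas, hH, hsymm, true_and, hdot, mulVec_mulVec, ← Matrix.mul_assoc]

theorem lfuObj_compress_le {n d : ℕ} {Q : Matrix (Fin n) (Fin d) ℝ} (hQ : Qᵀ * Q = 1)
    (Hbar H : Matrix (Fin n) (Fin n) ℝ) (α : Fin n → ℝ) (β : Fin d → ℝ) :
    LFUObj (Qᵀ * Hbar * Q) (β, Qᵀ * H * Q) ≤ LFUObj Hbar (α, H) := by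
  have h := frobSq_compress_le hQ (H - Hbar)
  rw [Matrix.mul_sub, Matrix.sub_mul] at h
  simp only [LFUObj]
  linarith

/-- For `Q` with orthonormal columns, the matrix closest to `Hbar` in Frobenius norm whose
compression `Qᵀ * H * Q` is `G`. -/
noncomputable def liftHessian {n d : ℕ} (Q : Matrix (Fin n) (Fin d) ℝ)
    (Hbar : Matrix (Fin n) (Fin n) ℝ) (G : Matrix (Fin d) (Fin d) ℝ) :
    Matrix (Fin n) (Fin n) ℝ :=
  Hbar + Q * (G - Qᵀ * Hbar * Q) * Qᵀ

theorem liftHessian_isSymm {n d : ℕ} (Q : Matrix (Fin n) (Fin d) ℝ)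
    {Hbar : Matrix (Fin n) (Fin n) ℝ} {G : Matrix (Fin d) (Fin d) ℝ}
    (hHbar : Hbar.IsSymm) (hG : G.IsSymm) : (liftHessian Q Hbar G).IsSymm := by
  simp only [liftHessian, IsSymm, transpose_add, transpose_sub, transpose_mul,
    transpose_transpose, hHbar.eq, hG.eq, Matrix.mul_assoc]

theorem compress_liftHessian {n d : ℕ} {Q : Matrix (Fin n) (Fin d) ℝ} (hQ : Qᵀ * Q = 1)
    (Hbar : Matrix (Fin n) (Fin n) ℝ) (G : Matrix (Fin d) (Fin d) ℝ) :
    Qᵀ * liftHessian Q Hbar G * Q = G := by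
  rw [liftHessian, Matrix.mul_add, Matrix.add_mul, transpose_mul_conj hQ, add_sub_cancel]

theorem lfuObj_liftHessian {n d : ℕ} {Q : Matrix (Fin n) (Fin d) ℝ} (hQ : Qᵀ * Q = 1)
    (Hbar : Matrix (Fin n) (Fin n) ℝ) (G : Matrix (Fin d) (Fin d) ℝ)
    (α : Fin n → ℝ) (β : Fin d → ℝ) :
    LFUObj Hbar (α, liftHessian Q Hbar G) = LFUObj (Qᵀ * Hbar * Q) (β, G) := by
  simp only [LFUObj, liftHessian, add_sub_cancel_left, frobSq_conj hQ]

theorem transpose_mulVec_mulVec {n d : ℕ} {Q : Matrix (Fin n) (Fin d) ℝ} (hQ : Qᵀ * Q = 1)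
    (u : Fin d → ℝ) : Qᵀ.mulVec (Q.mulVec u) = u := by
  rw [mulVec_mulVec, hQ, one_mulVec]

theorem inColPerp_iff {n d : ℕ} (Q : Matrix (Fin n) (Fin d) ℝ) (v : Fin n → ℝ) :
    inColPerp Q v ↔ Qᵀ.mulVec v = 0 := by
  have hdot (u : Fin d → ℝ) : Q.mulVec u ⬝ᵥ v = Qᵀ.mulVec v ⬝ᵥ u := by
    rw [dotProduct_comm, dotProduct_mulVec, mulVec_transpose]
  simp only [inColPerp, hdot, dotProduct_eq_zero_iff]

/-- If the full-space LFU problem is feasible, then the set of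
gradient components of minimizers of the full-space LFU problem equals
`{Q α̂ + v : (α̂, Ĥ) a subspace LFU minimizer, v ∈ col(Q)⊥}`. -/
theorem stmt_10 {n d m : ℕ} (hn : 0 < n) (hd : 0 < d) (hm : 0 < m) (hdn : d < n)
    (Q : Matrix (Fin n) (Fin d) ℝ) (hQ : Qᵀ * Q = 1)
    (f : (Fin n → ℝ) → ℝ) (x0 : Fin n → ℝ) (dh : Fin m → Fin d → ℝ)
    (fh : (Fin d → ℝ) → ℝ) (hfh : ∀ xh, fh xh = f (x0 + Q.mulVec xh))
    (Hbar : Matrix (Fin n) (Fin n) ℝ) (hHbar : Hbar.IsSymm)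
    (hfeas : ∃ p, QFeas (fun i => Q.mulVec (dh i))
      (fun i => f (x0 + Q.mulVec (dh i)) - f x0) p) :
    {α : Fin n → ℝ | ∃ H, LFUMin (fun i => Q.mulVec (dh i))
        (fun i => f (x0 + Q.mulVec (dh i)) - f x0) Hbar (α, H)} =
    {α : Fin n → ℝ | ∃ (αh : Fin d → ℝ) (Hh : Matrix (Fin d) (Fin d) ℝ) (v : Fin n → ℝ),
        LFUMin dh (fun i => fh (dh i) - fh 0) (Qᵀ * Hbar * Q) (αh, Hh) ∧
        inColPerp Q v ∧ α = Q.mulVec αh + v} := by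
  have hrhs : (fun i => fh (dh i) - fh 0) = fun i => f (x0 + Q.mulVec (dh i)) - f x0 := by
    simp only [hfh, mulVec_zero, add_zero]
  rw [hrhs]
  ext α
  constructor
  · rintro ⟨H, hfeasH, hmin⟩
    refine ⟨Qᵀ.mulVec α, Qᵀ * H * Q, α - Q.mulVec (Qᵀ.mulVec α),
      ⟨(qFeas_mulVec_iff Q dh _ α hfeasH.1).1 hfeasH, ?_⟩, ?_, (add_sub_cancel _ _).symm⟩
    · rintro ⟨β, G⟩ hG
      have hlift := hmin (Q.mulVec β, liftHessian Q Hbar G) <| by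
        rw [qFeas_mulVec_iff Q dh _ _ (liftHessian_isSymm Q hHbar hG.1),
          transpose_mulVec_mulVec hQ, compress_liftHessian hQ]
        exact hG
      rw [lfuObj_liftHessian hQ Hbar G _ β] at hlift
      exact (lfuObj_compress_le hQ Hbar H α _).trans hlift
    · rw [inColPerp_iff, mulVec_sub, transpose_mulVec_mulVec hQ, sub_self]
  · rintro ⟨αh, Hh, v, ⟨hfeasH, hmin⟩, hv, rfl⟩
    refine ⟨liftHessian Q Hbar Hh, ?_, ?_⟩
    · rw [qFeas_mulVec_iff Q dh _ _ (liftHessian_isSymm Q hHbar hfeasH.1), mulVec_add,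
        transpose_mulVec_mulVec hQ, (inColPerp_iff Q v).1 hv, add_zero, compress_liftHessian hQ]
      exact hfeasH
    · rintro ⟨β, G⟩ hG
      rw [lfuObj_liftHessian hQ Hbar Hh _ αh]
      exact (hmin _ ((qFeas_mulVec_iff Q dh _ β hG.1).1 hG)).trans
        (lfuObj_compress_le hQ Hbar G β _)
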